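/- arXiv:2210.00730 — 6 statements merged into one kernel-verified Lean document; each statement's English description precedes it below -/
import Mathlib

section
/- Assume n ≥ 4, α_1 = ⋯ = α_{n−1} = α and α_n = β. Let λ_min be the smallest eigenvalue of A. Then λ_min ≥ λ for every real number λ satisfying λ ≤ 1 − 2α, λ < 1 − β, and α² ≤ (1 − α − λ)(1 − β − λ). In particular, if α < 1/2, β < 1 and α² < (1 − α)(1 − β), then A is positive definite. -/
theorem Fin.val_add_one_cyclic {n : ℕ} [NeZero n] (hn : 2 ≤ n) (i : Fin n) :
    ((i + 1 : Fin n) : ℕ) = if (i : ℕ) = n - 1 then 0 else (i : ℕ) + 1 := by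
  have hi := i.isLt
  rw [Fin.val_add, Fin.val_one', Nat.mod_eq_of_lt (by omega : 1 < n)]
  split_ifs with h
  · rw [h, Nat.sub_add_cancel (by omega), Nat.mod_self]
  · exact Nat.mod_eq_of_lt (by omega)

/-- The quadratic form of a cyclic tridiagonal matrix with unit diagonal. -/
theorem dotProduct_mulVec_cyclic {n : ℕ} [NeZero n] (hn : 3 ≤ n) (α : Fin n → ℝ)
    (A : Matrix (Fin n) (Fin n) ℝ)
    (hAdef : ∀ i j : Fin n, A i j =
      if i = j then 1 else if j = i + 1 then -α i else if i = j + 1 then -α j else 0)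
    (x : Fin n → ℝ) :
    x ⬝ᵥ A.mulVec x = ∑ i, x i ^ 2 - 2 * ∑ i, α i * x i * x (i + 1) := by
  have entry : ∀ i j : Fin n, A i j = (if i = j then 1 else 0)
      - (if j = i + 1 then α i else 0) - (if i = j + 1 then α j else 0) := by
    intro i j
    have hi := Fin.val_add_one_cyclic (by omega) i
    have hj := Fin.val_add_one_cyclic (by omega) j
    rw [hAdef]
    simp only [Fin.ext_iff, hi, hj]
    have := i.isLt
    have := j.isLt
    split_ifs <;> first | omega | ring
  have expand : x ⬝ᵥ A.mulVec x = ∑ i, ∑ j, ((if i = j then x i * x j else 0)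
      - (if j = i + 1 then α i * x i * x j else 0)
      - (if i = j + 1 then α j * x i * x j else 0)) := by
    simp only [dotProduct, Matrix.mulVec, Finset.mul_sum]
    refine Finset.sum_congr rfl fun i _ => Finset.sum_congr rfl fun j _ => ?_
    rw [entry]
    split_ifs <;> ring
  have third : ∑ i, ∑ j, (if i = j + 1 then α j * x i * x j else 0)
      = ∑ i, α i * x i * x (i + 1) := by
    rw [Finset.sum_comm]
    refine Finset.sum_congr rfl fun j _ => ?_
    rw [Finset.sum_ite_eq' Finset.univ (j + 1) fun i => α j * x i * x j]
    simp only [Finset.mem_univ, if_true]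
    ring
  rw [expand]
  simp only [Finset.sum_sub_distrib]
  rw [third]
  simp only [Finset.sum_ite_eq, Finset.sum_ite_eq', Finset.mem_univ, if_true]
  simp only [← pow_two]
  ring

/-- Splitting the vertex weight `s` into `p i` for the edge leaving `i` and `s - p i` for the
edge entering `i` bounds a cyclic sum of products by the sum of squares. -/
theorem two_mul_sum_cyclic_le {n : ℕ} [NeZero n] (α p x : Fin n → ℝ) (s : ℝ)
    (hp : ∀ i, 0 < p i) (h : ∀ i, α i ^ 2 ≤ p i * (s - p (i + 1))) :
    2 * ∑ i, α i * x i * x (i + 1) ≤ s * ∑ i, x i ^ 2 := by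
  have edge : ∀ i, 2 * (α i * x i * x (i + 1))
      ≤ p i * x i ^ 2 + (s - p (i + 1)) * x (i + 1) ^ 2 := by
    intro i
    refine le_of_mul_le_mul_left ?_ (hp i)
    nlinarith [sq_nonneg (p i * x i - α i * x (i + 1)),
      mul_le_mul_of_nonneg_right (h i) (sq_nonneg (x (i + 1)))]
  have shift : ∑ i, (s - p (i + 1)) * x (i + 1) ^ 2 = ∑ i, (s - p i) * x i ^ 2 :=
    Equiv.sum_comp (Equiv.addRight (1 : Fin n)) fun i => (s - p i) * x i ^ 2
  calc 2 * ∑ i, α i * x i * x (i + 1) = ∑ i, 2 * (α i * x i * x (i + 1)) := Finset.mul_sum ..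
    _ ≤ ∑ i, (p i * x i ^ 2 + (s - p (i + 1)) * x (i + 1) ^ 2) :=
      Finset.sum_le_sum fun i _ => edge i
    _ = s * ∑ i, x i ^ 2 := by
      rw [Finset.sum_add_distrib, shift, ← Finset.sum_add_distrib, Finset.mul_sum]
      exact Finset.sum_congr rfl fun i _ => by ring

theorem two_mul_sum_cyclic_le_of_eq_except_last {n : ℕ} [NeZero n] (hn : 4 ≤ n) {a b s : ℝ}
    (ha : 0 < a) (hb : 0 < b) (α : Fin n → ℝ)
    (hα : ∀ i : Fin n, α i = if (i : ℕ) = n - 1 then b else a)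
    (hsa : 2 * a ≤ s) (hs : a ^ 2 ≤ (s - a) * (s - b)) (x : Fin n → ℝ) :
    2 * ∑ i, α i * x i * x (i + 1) ≤ s * ∑ i, x i ^ 2 := by
  have hsa' : 0 < s - a := by linarith
  obtain ⟨t, ht⟩ : ∃ t, t = a ^ 2 / (s - a) := ⟨_, rfl⟩
  have ht0 : 0 < t := by rw [ht]; positivity
  have hta : t * (s - a) = a ^ 2 := by rw [ht]; field_simp
  have htb : t ≤ s - b := by rw [ht, div_le_iff₀ hsa']; linarith
  refine two_mul_sum_cyclic_le α (fun i => if (i : ℕ) = 0 then t else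
    if (i : ℕ) = n - 2 then s - a else if (i : ℕ) = n - 1 then b else a) x s ?_ ?_
  · intro i
    split_ifs <;> assumption
  · intro i
    have hi := i.isLt
    have hi1 := Fin.val_add_one_cyclic (by omega) i
    simp only [hi1, hα]
    split_ifs <;> first | contradiction | omega | nlinarith

/-- In the setting of the cyclic tridiagonal matrix `A` (diagonal `1`,
`A_{i,i+1} = A_{i+1,i} = -α_i` for `i = 1, …, n-1`, `A_{1,n} = A_{n,1} = -α_n`), assume
`n ≥ 4`, `α_1 = ⋯ = α_{n-1} = a` and `α_n = b`.  Then the smallest eigenvalue of `A`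
is `≥ λ` for every real `λ` with `λ ≤ 1 - 2a`, `λ < 1 - b` and
`a² ≤ (1 - a - λ)(1 - b - λ)`.  In particular, if `a < 1/2`, `b < 1` and
`a² < (1 - a)(1 - b)`, then `A` is positive definite.
"`λ_min ≥ λ`" is expressed as `λ ≤ μ` for every eigenvalue `μ` of `A`. -/
theorem stmt2 (n : ℕ) [NeZero n] (hn : 4 ≤ n) (a b : ℝ) (ha : 0 < a) (hb : 0 < b)
    (α : Fin n → ℝ)
    (hα1 : ∀ i : Fin n, (i : ℕ) < n - 1 → α i = a)
    (hα2 : α ⟨n - 1, by omega⟩ = b)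
    (A : Matrix (Fin n) (Fin n) ℝ)
    (hAdef : ∀ i j : Fin n, A i j =
      if i = j then 1 else if j = i + 1 then -α i else if i = j + 1 then -α j else 0)
    (hA : A.IsHermitian) :
    (∀ lam : ℝ, lam ≤ 1 - 2 * a → lam < 1 - b →
      a ^ 2 ≤ (1 - a - lam) * (1 - b - lam) → ∀ i, lam ≤ hA.eigenvalues i) ∧
    (a < 1 / 2 → b < 1 → a ^ 2 < (1 - a) * (1 - b) → A.PosDef) := by
  have hα : ∀ i : Fin n, α i = if (i : ℕ) = n - 1 then b else a := by
    intro i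
    have hi := i.isLt
    split_ifs with h
    · rw [← hα2]
      exact congrArg α (Fin.ext h)
    · exact hα1 i (by omega)
  have lower : ∀ lam : ℝ, lam ≤ 1 - 2 * a → lam < 1 - b →
      a ^ 2 ≤ (1 - a - lam) * (1 - b - lam) → ∀ i, lam ≤ hA.eigenvalues i := by
    intro lam h1 _ h3 i
    obtain ⟨v, hv⟩ : ∃ v : Fin n → ℝ, v = ⇑(hA.eigenvectorBasis i) := ⟨_, rfl⟩
    have hmul : A.mulVec v = hA.eigenvalues i • v := by
      rw [hv]
      exact hA.mulVec_eigenvectorBasis i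
    have hnorm : ∑ j, v j ^ 2 = 1 := by
      have := EuclideanSpace.real_norm_sq_eq (hA.eigenvectorBasis i)
      rw [hA.eigenvectorBasis.orthonormal.1 i] at this
      rw [hv, ← this, one_pow]
    have hform := dotProduct_mulVec_cyclic (by omega) α A hAdef v
    have hself : v ⬝ᵥ v = ∑ j, v j ^ 2 := by simp only [dotProduct, pow_two]
    rw [hmul, dotProduct_smul, hself, hnorm, smul_eq_mul] at hform
    have hle := two_mul_sum_cyclic_le_of_eq_except_last hn ha hb α hα (s := 1 - lam)
      (by linarith) (by linarith) v
    rw [hnorm] at hle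
    linarith
  refine ⟨lower, fun h1 h2 h3 => hA.posDef_iff_eigenvalues_pos.mpr fun i => ?_⟩
  have hd : 0 < 2 - a - b := by linarith
  obtain ⟨d, hd_def⟩ : ∃ d, d = ((1 - a) * (1 - b) - a ^ 2) / (2 - a - b) := ⟨_, rfl⟩
  have hd0 : 0 < d := by
    rw [hd_def]
    exact div_pos (by linarith) hd
  have hdm : d * (2 - a - b) = (1 - a) * (1 - b) - a ^ 2 := by
    rw [hd_def]
    field_simp
  have hdb : d < 1 - b := by nlinarith
  have hmin : 0 < min d (1 - 2 * a) := lt_min hd0 (by linarith)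
  refine hmin.trans_le (lower _ (min_le_right _ _) ((min_le_left _ _).trans_lt hdb) ?_ i)
  nlinarith [mul_le_mul_of_nonneg_right (min_le_left d (1 - 2 * a)) hd.le]
end

section
/- Let N ≥ 1 be an integer, let p > N be a prime, and let F_q be a finite field of order q = p^l. For each nonzero γ ∈ F_q, the number of elements α ∈ F_q such that the subfield of F_q generated by α^N·γ is all of F_q is at least (1 − N/p)·q. -/
theorem Nat.sum_properDivisors_pow_le {p : ℕ} (hp : 2 ≤ p) (l : ℕ) :
    ∑ d ∈ l.properDivisors, p ^ d ≤ p ^ (l - 1) := by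
  rcases Nat.lt_or_ge l 3 with h | h
  · interval_cases l
    · simp
    · simp
    · rw [Nat.Prime.properDivisors Nat.prime_two]
      simp
  · have hsub : l.properDivisors ⊆ Finset.range (l - 1) := by
      intro d hd
      obtain ⟨⟨k, rfl⟩, hlt⟩ := Nat.mem_properDivisors.1 hd
      have hk : 2 ≤ k := by
        by_contra! hk
        interval_cases k <;> omega
      have hle : d * 2 ≤ d * k := Nat.mul_le_mul_left d hk
      rw [Finset.mem_range]
      omega
    exact (Finset.sum_le_sum_of_subset hsub).trans
      (Nat.geomSum_lt hp fun _ hd => Finset.mem_range.1 hd).le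

theorem Subfield.exists_pow_card_eq_self_of_ne_top {F : Type*} [Field F] [Fintype F]
    {p l : ℕ} (hp : p.Prime) (hcard : Fintype.card F = p ^ l) (hl : l ≠ 0)
    {S : Subfield F} (hS : S ≠ ⊤) :
    ∃ d ∈ l.properDivisors, ∀ x ∈ S, x ^ p ^ d = x := by
  classical
  have : Fintype S := Fintype.ofFinite S
  have hpow : Fintype.card F = Fintype.card S ^ Module.finrank S F :=
    Module.card_eq_pow_finrank
  have hn : Module.finrank S F ≠ 0 := Module.finrank_pos.ne'
  obtain ⟨d, hdl, hd⟩ := (Nat.dvd_prime_pow hp).1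
    ((dvd_pow_self (Fintype.card S) hn).trans (dvd_of_eq (hpow.symm.trans hcard)))
  have hmul : l = d * Module.finrank S F := by
    apply Nat.pow_right_injective hp.two_le
    simpa only [pow_mul, ← hd, ← hpow] using hcard.symm
  refine ⟨d, Nat.mem_properDivisors.2 ⟨⟨_, hmul⟩, lt_of_le_of_ne hdl ?_⟩, fun x hx => ?_⟩
  · rintro rfl
    apply hS
    apply SetLike.coe_injective
    rw [Subfield.coe_top]
    apply Set.eq_univ_of_forall
    have hbij := (Fintype.bijective_iff_injective_and_card (Subtype.val : S → F)).2
      ⟨Subtype.val_injective, hd.trans hcard.symm⟩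
    intro x
    obtain ⟨y, rfl⟩ := hbij.2 x
    exact y.2
  · have := FiniteField.pow_card (⟨x, hx⟩ : S)
    rw [hd] at this
    exact congrArg Subtype.val this

theorem FiniteField.card_closure_singleton_ne_top_le {F : Type*} [Field F] [Fintype F]
    {p l : ℕ} (hp : p.Prime) (hcard : Fintype.card F = p ^ l) (hl : l ≠ 0)
    (s : Finset F) (hs : ∀ x ∈ s, Subfield.closure {x} ≠ ⊤) :
    s.card ≤ p ^ (l - 1) := by
  classical
  have hsub : s ⊆ l.properDivisors.biUnion
      fun d => (Polynomial.X ^ p ^ d - Polynomial.X : Polynomial F).roots.toFinset := by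
    intro x hx
    obtain ⟨d, hd, h⟩ := Subfield.exists_pow_card_eq_self_of_ne_top hp hcard hl (hs x hx)
    have hd0 : d ≠ 0 := (Nat.pos_of_mem_properDivisors hd).ne'
    rw [Finset.mem_biUnion]
    refine ⟨d, hd, ?_⟩
    rw [Multiset.mem_toFinset, Polynomial.mem_roots
      (FiniteField.X_pow_card_pow_sub_X_ne_zero F hd0 hp.one_lt)]
    simp [h x (Subfield.subset_closure rfl)]
  refine (Finset.card_le_card hsub).trans (Finset.card_biUnion_le.trans
    ((Finset.sum_le_sum fun d hd => ?_).trans (Nat.sum_properDivisors_pow_le hp.two_le l)))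
  have hd0 : d ≠ 0 := (Nat.pos_of_mem_properDivisors hd).ne'
  refine (Multiset.toFinset_card_le _).trans ((Polynomial.card_roots' _).trans ?_)
  rw [FiniteField.X_pow_card_pow_sub_X_natDegree_eq F hd0 hp.one_lt]

/-- Let `N ≥ 1` be an integer, `p > N` a prime, and `F` a finite field of
order `q = p ^ l`. For each nonzero `γ ∈ F`, the number of elements `α ∈ F` such that the
subfield of `F` generated by `α ^ N * γ` is all of `F` is at least `(1 - N/p) * q`. -/
theorem stmt3 (N p l : ℕ) (hN : 1 ≤ N) (hp : p.Prime) (hNp : N < p) (hl : 1 ≤ l)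
    (F : Type) [Field F] [Fintype F] (hcard : Fintype.card F = p ^ l)
    (γ : F) (hγ : γ ≠ 0) :
    (1 - (N : ℝ) / p) * (p : ℝ) ^ l ≤
      (Nat.card {α : F // Subfield.closure {α ^ N * γ} = ⊤} : ℝ) := by
  classical
  have hbad : (Finset.univ.filter
      fun α : F => ¬ Subfield.closure {α ^ N * γ} = ⊤).card ≤ N * p ^ (l - 1) := by
    refine (Finset.card_le_mul_card_image (f := fun α : F => α ^ N * γ) _ N
      fun β _ => ?_).trans (Nat.mul_le_mul_left N
        (FiniteField.card_closure_singleton_ne_top_le hp hcard (by omega) _ fun x hx => ?_))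
    · refine (Finset.card_le_card (t := (Polynomial.nthRoots N (β / γ)).toFinset) ?_).trans
        ((Multiset.toFinset_card_le _).trans (Polynomial.card_nthRoots _ _))
      intro α hα
      rw [Multiset.mem_toFinset, Polynomial.mem_nthRoots hN]
      exact eq_div_of_mul_eq hγ (Finset.mem_filter.1 hα).2
    · obtain ⟨α, hα, rfl⟩ := Finset.mem_image.1 hx
      exact (Finset.mem_filter.1 hα).2
  have hsum := Finset.card_filter_add_card_filter_not (s := (Finset.univ : Finset F))
    (fun α : F => Subfield.closure {α ^ N * γ} = ⊤)
  rw [Finset.card_univ, hcard] at hsum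
  rw [Nat.card_eq_fintype_card, Fintype.card_subtype]
  have hle : p ^ l ≤ (Finset.univ.filter
      fun α : F => Subfield.closure {α ^ N * γ} = ⊤).card + N * p ^ (l - 1) := by omega
  have hle' : (p : ℝ) ^ l ≤ ((Finset.univ.filter
      fun α : F => Subfield.closure {α ^ N * γ} = ⊤).card : ℝ) + N * (p : ℝ) ^ (l - 1) := by
    exact_mod_cast hle
  have hp0 : (p : ℝ) ≠ 0 := Nat.cast_ne_zero.2 hp.ne_zero
  have hpow : (N : ℝ) / p * (p : ℝ) ^ l = N * (p : ℝ) ^ (l - 1) := by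
    obtain ⟨m, rfl⟩ := Nat.exists_eq_add_of_le' hl
    rw [Nat.add_sub_cancel, pow_succ]
    field_simp
  rw [sub_mul, one_mul, hpow]
  linarith
end

section
/- Let p be a prime and let k, N be integers with 0 ≤ k < N < p. Let α, β be elements of the algebraic closure of F_p with α ≠ 0. Then there exists λ ∈ F_p(α^N) such that the cardinality of F_p((β + λ·α^k)^N) is at least the cardinality of F_p(α^N). -/
open Polynomial in
/-- The polynomial whose roots are the `x` such that `x ^ N` lies in a subfield with `p ^ d` elements
for some `1 ≤ d < n` has degree less than `p ^ n` when `N < p`. -/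
theorem exists_ne_zero_natDegree_lt_forall_isRoot {F : Type*} [Field F] {p N n : ℕ} (hp : 1 < p)
    (hN : 0 < N) (hNp : N < p) :
    ∃ P : F[X], P ≠ 0 ∧ P.natDegree < p ^ n ∧
      ∀ d ∈ Finset.Ico 1 n, ∀ x : F, (x ^ N) ^ p ^ d = x ^ N → P.IsRoot x := by
  have hlt : ∀ d ∈ Finset.Ico 1 n, N < N * p ^ d := fun d hd =>
    lt_mul_of_one_lt_right hN (Nat.one_lt_pow (by grind) hp)
  have hdeg : ∀ d ∈ Finset.Ico 1 n, (X ^ (N * p ^ d) - X ^ N : F[X]).natDegree = N * p ^ d :=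
    fun d hd => by
      rw [natDegree_sub_eq_left_of_natDegree_lt] <;> simp [hlt d hd]
  have hne : ∀ d ∈ Finset.Ico 1 n, (X ^ (N * p ^ d) - X ^ N : F[X]) ≠ 0 := fun d hd h => by
    have h1 := hdeg d hd
    have h2 := hlt d hd
    rw [h, natDegree_zero] at h1
    omega
  refine ⟨∏ d ∈ Finset.Ico 1 n, (X ^ (N * p ^ d) - X ^ N), Finset.prod_ne_zero_iff.2 hne, ?_, ?_⟩
  · rw [natDegree_prod _ _ hne, Finset.sum_congr rfl hdeg, ← Finset.mul_sum]
    calc N * ∑ d ∈ Finset.Ico 1 n, p ^ d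
        ≤ (p - 1) * ∑ d ∈ Finset.range n, p ^ d := by
          gcongr
          · omega
          · intro d hd
            grind
      _ = p ^ n - 1 := by
          rw [mul_comm, Nat.geomSum_eq hp, Nat.div_mul_cancel (Nat.sub_one_dvd_pow_sub_one _ _)]
      _ < p ^ n := Nat.sub_lt (by positivity) one_pos
  · intro d hd x hx
    rw [IsRoot.def, eval_prod]
    refine Finset.prod_eq_zero hd ?_
    simp [pow_mul, hx]

/-- A subfield generated by one element of an algebraic extension of `ZMod p` is finite. -/
theorem finite_subfieldClosure_singleton (p : ℕ) [Fact p.Prime] {F : Type*} [Field F]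
    [Algebra (ZMod p) F] [Algebra.IsAlgebraic (ZMod p) F] (x : F) :
    Finite (Subfield.closure ({x} : Set F)) := by
  have hfin : FiniteDimensional (ZMod p) (IntermediateField.adjoin (ZMod p) {x}) :=
    IntermediateField.adjoin.finiteDimensional (Algebra.IsIntegral.isIntegral x)
  have : Finite (IntermediateField.adjoin (ZMod p) {x}) := Module.finite_of_finite (ZMod p)
  have hle : Subfield.closure ({x} : Set F) ≤
      (IntermediateField.adjoin (ZMod p) {x}).toSubfield :=
    Subfield.closure_le.2 (IntermediateField.subset_adjoin (ZMod p) {x})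
  exact Set.Finite.subset (Set.toFinite (IntermediateField.adjoin (ZMod p) {x} : Set F)) hle

/-- A finite subfield of a field of characteristic `p` has `p ^ n` elements for some `0 < n`. -/
theorem Subfield.exists_natCard_eq_pow (p : ℕ) [Fact p.Prime] {F : Type*} [Field F] [CharP F p]
    (K : Subfield F) [Finite K] : ∃ n, 0 < n ∧ Nat.card K = p ^ n := by
  have := Fintype.ofFinite K
  obtain ⟨n, -, hn⟩ := FiniteField.card K p
  exact ⟨n, n.pos, by rw [Nat.card_eq_fintype_card, hn]⟩

/-- Let `p` be a prime and `k, N` integers with `0 ≤ k < N < p`.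
Let `α, β` be elements of the algebraic closure of `F_p` with `α ≠ 0`. Then there exists
`λ ∈ F_p(α^N)` such that the cardinality of `F_p((β + λ·α^k)^N)` is at least the
cardinality of `F_p(α^N)`.  Here `F_p(x, …)` is formalized as the subfield of the algebraic
closure generated by the given elements (it automatically contains the prime field). -/
theorem stmt4 (p : ℕ) [Fact p.Prime] (k N : ℕ) (hkN : k < N) (hNp : N < p)
    (α β : AlgebraicClosure (ZMod p)) (hα : α ≠ 0) :
    ∃ lam ∈ Subfield.closure ({α ^ N} : Set (AlgebraicClosure (ZMod p))),
      Nat.card (Subfield.closure ({α ^ N} : Set (AlgebraicClosure (ZMod p)))) ≤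
        Nat.card (Subfield.closure ({(β + lam * α ^ k) ^ N} :
          Set (AlgebraicClosure (ZMod p)))) := by
  classical
  by_contra! h
  have hfin := finite_subfieldClosure_singleton p (F := AlgebraicClosure (ZMod p))
  have hchar : CharP (AlgebraicClosure (ZMod p)) p := inferInstance
  have hp : 1 < p := (Fact.out : p.Prime).one_lt
  have := hfin (α ^ N)
  obtain ⟨n, -, hn⟩ := (Subfield.closure {α ^ N}).exists_natCard_eq_pow p
  obtain ⟨P, hP0, hPdeg, hP⟩ := exists_ne_zero_natDegree_lt_forall_isRoot
    (F := AlgebraicClosure (ZMod p)) (n := n) hp (by omega) hNp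
  have hroot : ∀ lam ∈ Subfield.closure {α ^ N}, P.IsRoot (β + lam * α ^ k) := by
    intro lam hlam
    set y := (β + lam * α ^ k) ^ N with hy
    have := hfin y
    obtain ⟨d, hd0, hd⟩ := (Subfield.closure {y}).exists_natCard_eq_pow p
    have hdn : d < n := (Nat.pow_lt_pow_iff_right hp).1 (hd ▸ hn ▸ h lam hlam)
    refine hP d (Finset.mem_Ico.2 ⟨hd0, hdn⟩) _ ?_
    have := Fintype.ofFinite (Subfield.closure {y})
    have hpow := FiniteField.pow_card
      (⟨y, Subfield.subset_closure rfl⟩ : Subfield.closure {y})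
    rw [← Nat.card_eq_fintype_card, hd] at hpow
    exact congrArg Subtype.val hpow
  let f : Subfield.closure {α ^ N} → {x // x ∈ P.roots.toFinset} := fun lam =>
    ⟨β + lam * α ^ k, by simpa [hP0] using hroot lam lam.2⟩
  have hf : Function.Injective f := fun a b hab =>
    Subtype.ext (mul_right_cancel₀ (pow_ne_zero k hα) (add_left_cancel (congrArg Subtype.val hab)))
  have hcard := Nat.card_le_card_of_injective f hf
  rw [hn, Nat.card_eq_fintype_card, Fintype.card_coe] at hcard
  exact absurd (hcard.trans ((Multiset.toFinset_card_le _).trans P.card_roots')) hPdeg.not_ge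
end

section
/- Let R be a commutative unital ring, n ≥ 3, let c ≥ 1 and d ≥ 0 be integers, and let i, j, k ∈ {1,…,n} be pairwise distinct. Then there exists an injective group homomorphism ψ : Γ_{c,R} → Aut(R[x_1,…,x_n]) such that ψ(r·x^{c−ℓ}) = β_{i;j,k}^{(c−ℓ, dℓ)}(r) for all r ∈ R and all ℓ ∈ {0,1,…,c}, and ψ(y(s)) = α_{j;k}^{(d)}(s) for all s ∈ R. In particular, if c! is invertible in R, then the subgroup of Aut(R[x_1,…,x_n]) generated by {α_{i;j}^{(c)}(r) : r ∈ R} ∪ {α_{j;k}^{(d)}(s) : s ∈ R} is isomorphic to Γ_{c,R} and contains β_{i;j,k}^{(c−ℓ, dℓ)}(r) for all r ∈ R and all ℓ ∈ {0,1,…,c}. -/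
/-- The shift `P(x) ↦ P(x + r)` as an additive automorphism of the group `R[x]_{≤ c}`
of polynomials of degree at most `c`. -/
noncomputable def taylorShift (R : Type) [CommRing R] (c : ℕ) (r : R) :
    Polynomial.degreeLE R c ≃+ Polynomial.degreeLE R c where
  toFun p := ⟨Polynomial.taylor r p.1, by
    rw [Polynomial.mem_degreeLE, ← Polynomial.natDegree_le_iff_degree_le,
      Polynomial.natDegree_taylor, Polynomial.natDegree_le_iff_degree_le]
    exact Polynomial.mem_degreeLE.1 p.2⟩
  invFun p := ⟨Polynomial.taylor (-r) p.1, by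
    rw [Polynomial.mem_degreeLE, ← Polynomial.natDegree_le_iff_degree_le,
      Polynomial.natDegree_taylor, Polynomial.natDegree_le_iff_degree_le]
    exact Polynomial.mem_degreeLE.1 p.2⟩
  left_inv p := Subtype.ext (by
    simp [Polynomial.taylor_taylor])
  right_inv p := Subtype.ext (by
    simp [Polynomial.taylor_taylor])
  map_add' p q := Subtype.ext (by simp)

/-- The action of `R` on (the multiplicative version of) `R[x]_{≤ c}` by shifts,
as a homomorphism to the automorphism group. -/
noncomputable def gammaPhi (R : Type) [CommRing R] (c : ℕ) :
    Multiplicative R →* MulAut (Multiplicative (Polynomial.degreeLE R c)) where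
  toFun r :=
    { toFun := fun p => Multiplicative.ofAdd (taylorShift R c r.toAdd p.toAdd)
      invFun := fun p => Multiplicative.ofAdd ((taylorShift R c r.toAdd).symm p.toAdd)
      left_inv := fun p => by simp
      right_inv := fun p => by simp
      map_mul' := fun p q => by
        show Multiplicative.ofAdd (taylorShift R c r.toAdd (p.toAdd + q.toAdd)) = _
        rw [map_add]
        rfl }
  map_one' := by
    refine MulEquiv.ext fun p => ?_
    show Multiplicative.ofAdd (taylorShift R c (Multiplicative.toAdd 1) p.toAdd) = p
    refine Multiplicative.toAdd.injective (Subtype.ext ?_)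
    show Polynomial.taylor (0 : R) (p.toAdd : Polynomial R) = (p.toAdd : Polynomial R)
    exact Polynomial.taylor_zero _
  map_mul' r s := by
    refine MulEquiv.ext fun p => ?_
    show Multiplicative.ofAdd (taylorShift R c (Multiplicative.toAdd (r * s)) p.toAdd) =
      Multiplicative.ofAdd (taylorShift R c r.toAdd ((taylorShift R c s.toAdd) p.toAdd))
    refine congrArg Multiplicative.ofAdd (Subtype.ext ?_)
    show Polynomial.taylor (r.toAdd + s.toAdd) (p.toAdd : Polynomial R) = _
    rw [← Polynomial.taylor_taylor]
    rfl

/-- The group `Γ_{c,R} = R[x]_{≤ c} ⋊ R`, where `R` acts by `P(x) ↦ P(x + r)`. -/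
def GammaGroup (R : Type) [CommRing R] (c : ℕ) : Type :=
  SemidirectProduct (Multiplicative (Polynomial.degreeLE R c)) (Multiplicative R)
    (gammaPhi R c)

noncomputable instance (R : Type) [CommRing R] (c : ℕ) : Group (GammaGroup R c) :=
  inferInstanceAs (Group (SemidirectProduct _ _ (gammaPhi R c)))

/-- The monomial `r·x^{c-i}` as an element of `R[x]_{≤ c}`, additively in `r`. -/
noncomputable def monoHom (R : Type) [CommRing R] (c i : ℕ) :
    R →+ Polynomial.degreeLE R c where
  toFun r := ⟨Polynomial.monomial (c - i) r, by
    rw [Polynomial.mem_degreeLE]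
    exact (Polynomial.degree_monomial_le _ _).trans (by exact_mod_cast Nat.sub_le c i)⟩
  map_zero' := Subtype.ext (by simp)
  map_add' a b := Subtype.ext (by simp)

/-- The subgroup `X_i(R) = {r·x^{c-i} : r ∈ R}` of `Γ_{c,R}`. -/
noncomputable def Xsub (R : Type) [CommRing R] (c i : ℕ) : Subgroup (GammaGroup R c) :=
  ((SemidirectProduct.inl :
      Multiplicative (Polynomial.degreeLE R c) →* GammaGroup R c).comp
    (AddMonoidHom.toMultiplicative (monoHom R c i))).range

/-- The subgroup `Y(R) = {y(r) : r ∈ R}` of `Γ_{c,R}`. -/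
noncomputable def Ysub (R : Type) [CommRing R] (c : ℕ) : Subgroup (GammaGroup R c) :=
  (SemidirectProduct.inr : Multiplicative R →* GammaGroup R c).range

open MvPolynomial

/-- The "polynomial transvection" `α_{i;j}^{(e)}(r)` : the `R`-algebra automorphism of
`R[x_1, …, x_n]` determined by `x_i ↦ x_i + r·x_j^e` and `x_ℓ ↦ x_ℓ` for `ℓ ≠ i`
(here `j ≠ i`). -/
noncomputable def transvection (R : Type) [CommRing R] (n : ℕ) (i j : Fin n) (hji : j ≠ i)
    (e : ℕ) (r : R) :
    MvPolynomial (Fin n) R ≃ₐ[R] MvPolynomial (Fin n) R :=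
  AlgEquiv.ofAlgHom
    (MvPolynomial.aeval fun l => if l = i then
      MvPolynomial.X i + MvPolynomial.C r * MvPolynomial.X j ^ e else MvPolynomial.X l)
    (MvPolynomial.aeval fun l => if l = i then
      MvPolynomial.X i - MvPolynomial.C r * MvPolynomial.X j ^ e else MvPolynomial.X l)
    (by apply MvPolynomial.algHom_ext; intro l
        by_cases h : l = i <;> simp [h, hji])
    (by apply MvPolynomial.algHom_ext; intro l
        by_cases h : l = i <;> simp [h, hji])

/-- The automorphism `β_{i;j,k}^{(c,d)}(r)` of `R[x_1,…,x_n]` determined by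
`x_i ↦ x_i + r·x_j^c·x_k^d` and `x_ℓ ↦ x_ℓ` for `ℓ ≠ i` (here `j ≠ i` and `k ≠ i`). -/
noncomputable def biTransvection (R : Type) [CommRing R] (n : ℕ) (i j k : Fin n)
    (hji : j ≠ i) (hki : k ≠ i) (cc dd : ℕ) (r : R) :
    MvPolynomial (Fin n) R ≃ₐ[R] MvPolynomial (Fin n) R :=
  AlgEquiv.ofAlgHom
    (MvPolynomial.aeval fun l => if l = i then
      MvPolynomial.X i + MvPolynomial.C r * MvPolynomial.X j ^ cc * MvPolynomial.X k ^ dd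
      else MvPolynomial.X l)
    (MvPolynomial.aeval fun l => if l = i then
      MvPolynomial.X i - MvPolynomial.C r * MvPolynomial.X j ^ cc * MvPolynomial.X k ^ dd
      else MvPolynomial.X l)
    (by apply MvPolynomial.algHom_ext; intro l
        by_cases h : l = i <;> simp [h, hji, hki])
    (by apply MvPolynomial.algHom_ext; intro l
        by_cases h : l = i <;> simp [h, hji, hki])

/-- The forward difference of a polynomial of degree at most `m + 1` has degree at most `m`, and
its coefficient of degree `m` is `m + 1` times the leading one. -/
theorem Polynomial.taylor_one_sub_self {R : Type*} [CommRing R] {m : ℕ} {p : Polynomial R}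
    (hp : p.natDegree ≤ m + 1) :
    (Polynomial.taylor 1 p - p).natDegree ≤ m ∧
      (Polynomial.taylor 1 p - p).coeff m = (m + 1 : ℕ) * p.coeff (m + 1) := by
  constructor
  · rw [Polynomial.natDegree_le_iff_coeff_eq_zero]
    intro N hN
    have h0 : (Polynomial.hasseDeriv N p).natDegree ≤ 0 :=
      (Polynomial.natDegree_hasseDeriv_le p N).trans (by omega)
    rw [Polynomial.coeff_sub, Polynomial.taylor_coeff, Polynomial.eq_C_of_natDegree_le_zero h0,
      Polynomial.eval_C, Polynomial.hasseDeriv_coeff]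
    simp
  · have h1 : (Polynomial.hasseDeriv m p).natDegree ≤ 1 :=
      (Polynomial.natDegree_hasseDeriv_le p m).trans (by omega)
    rw [Polynomial.coeff_sub, Polynomial.taylor_coeff,
      Polynomial.eq_X_add_C_of_natDegree_le_one h1, Polynomial.hasseDeriv_coeff,
      Polynomial.hasseDeriv_coeff]
    simp [add_comm 1 m]

/-- If `c!` is invertible, an additive group of polynomials that contains all `r·x^c` and is
stable under `P(x) ↦ P(x + 1)` contains all polynomials of degree at most `c`. -/
theorem Polynomial.mem_of_taylor_one_mem {R : Type*} [CommRing R] {c : ℕ}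
    (hc : IsUnit (c.factorial : R)) (N : AddSubgroup (Polynomial R))
    (hN : ∀ r : R, Polynomial.monomial c r ∈ N)
    (hT : ∀ p ∈ N, Polynomial.taylor 1 p ∈ N) :
    ∀ p : Polynomial R, p.natDegree ≤ c → p ∈ N := by
  have lead : ∀ k m, m + k = c → ∀ r : R, ∃ p ∈ N, p.natDegree ≤ m ∧ p.coeff m = r := by
    intro k
    induction k with
    | zero =>
      rintro m rfl r
      exact ⟨_, hN r, Polynomial.natDegree_monomial_le r, by simp⟩
    | succ k ih =>
      intro m hm r
      have hu : IsUnit ((m + 1 : ℕ) : R) :=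
        isUnit_of_dvd_unit
          (Nat.cast_dvd_cast (Nat.dvd_factorial (Nat.succ_pos m) (by omega))) hc
      obtain ⟨p, hpN, hp, hpr⟩ := ih (m + 1) (by omega) (↑hu.unit⁻¹ * r)
      obtain ⟨h1, h2⟩ := Polynomial.taylor_one_sub_self hp
      refine ⟨_, N.sub_mem (hT p hpN) hpN, h1, ?_⟩
      rw [h2, hpr, ← mul_assoc, IsUnit.mul_val_inv, one_mul]
  have key : ∀ m, m ≤ c → ∀ p : Polynomial R, p.natDegree ≤ m → p ∈ N := by
    intro m
    induction m with
    | zero =>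
      intro _ p hp
      obtain ⟨q, hqN, hq, hqp⟩ := lead c 0 (by omega) (p.coeff 0)
      rw [Polynomial.eq_C_of_natDegree_le_zero hp, ← hqp,
        ← Polynomial.eq_C_of_natDegree_le_zero hq]
      exact hqN
    | succ m ih =>
      intro hm p hp
      obtain ⟨q, hqN, hq, hqp⟩ := lead (c - (m + 1)) (m + 1) (by omega) (p.coeff (m + 1))
      have hpq : (p - q).natDegree ≤ m := by
        rw [Polynomial.natDegree_le_iff_coeff_eq_zero]
        intro M hM
        rcases (Nat.succ_le_of_lt hM).eq_or_lt with rfl | h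
        · simp [hqp]
        · rw [Polynomial.coeff_sub, Polynomial.coeff_eq_zero_of_natDegree_lt (hp.trans_lt h),
            Polynomial.coeff_eq_zero_of_natDegree_lt (hq.trans_lt h), sub_zero]
      simpa using N.add_mem (ih (by omega) _ hpq) hqN
  exact key c le_rfl

/-- The weighted homogenization `P ↦ x_k^{dc} P(x_j / x_k^d)` of polynomials of degree at
most `c`. -/
noncomputable def weightedHomogenization (R : Type) [CommRing R] {n : ℕ} (c d : ℕ) (j k : Fin n) :
    Polynomial R →ₗ[R] MvPolynomial (Fin n) R :=
  ∑ m ∈ Finset.range (c + 1),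
    (Polynomial.lcoeff R m).smulRight
      (MvPolynomial.X j ^ m * MvPolynomial.X k ^ (d * (c - m)))

section weightedHomogenization

variable {R : Type} [CommRing R] {n c d : ℕ} {j k : Fin n}

theorem weightedHomogenization_apply (p : Polynomial R) :
    weightedHomogenization R c d j k p =
      ∑ m ∈ Finset.range (c + 1),
        p.coeff m • (MvPolynomial.X j ^ m * MvPolynomial.X k ^ (d * (c - m))) := by
  simp [weightedHomogenization]

theorem weightedHomogenization_monomial {m : ℕ} (hm : m ≤ c) (r : R) :
    weightedHomogenization R c d j k (Polynomial.monomial m r) =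
      r • (MvPolynomial.X j ^ m * MvPolynomial.X k ^ (d * (c - m))) := by
  rw [weightedHomogenization_apply, Finset.sum_eq_single m]
  · simp
  · intro b _ hb
    rw [Polynomial.coeff_monomial_of_ne r hb, zero_smul]
  · intro h
    exact absurd (Finset.mem_range.2 (Nat.lt_succ_of_le hm)) h

/-- Setting `x_j = x` and `x_k = 1` recovers the polynomial. -/
theorem aeval_weightedHomogenization (hjk : j ≠ k) {p : Polynomial R}
    (hp : p ∈ Polynomial.degreeLE R c) :
    MvPolynomial.aeval (fun l => if l = j then (Polynomial.X : Polynomial R) else 1)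
      (weightedHomogenization R c d j k p) = p := by
  rw [Polynomial.mem_degreeLE, ← Polynomial.natDegree_le_iff_degree_le] at hp
  rw [weightedHomogenization_apply, map_sum]
  conv_rhs => rw [p.as_sum_range_C_mul_X_pow' (Nat.lt_succ_of_le hp)]
  refine Finset.sum_congr rfl fun m _ => ?_
  simp [hjk.symm, Polynomial.smul_eq_C_mul]

theorem map_weightedHomogenization_of_fixed
    (f : MvPolynomial (Fin n) R →ₐ[R] MvPolynomial (Fin n) R)
    (hj : f (MvPolynomial.X j) = MvPolynomial.X j) (hk : f (MvPolynomial.X k) = MvPolynomial.X k)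
    (p : Polynomial R) :
    f (weightedHomogenization R c d j k p) = weightedHomogenization R c d j k p := by
  simp [weightedHomogenization_apply, hj, hk]

/-- Homogenization turns the shift `x ↦ x + s` into `x_j ↦ x_j + s·x_k^d`. -/
theorem weightedHomogenization_taylor
    (f : MvPolynomial (Fin n) R →ₐ[R] MvPolynomial (Fin n) R) (s : R)
    (hj : f (MvPolynomial.X j) =
      MvPolynomial.X j + MvPolynomial.C s * MvPolynomial.X k ^ d)
    (hk : f (MvPolynomial.X k) = MvPolynomial.X k) {p : Polynomial R}
    (hp : p ∈ Polynomial.degreeLE R c) :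
    weightedHomogenization R c d j k (Polynomial.taylor s p) =
      f (weightedHomogenization R c d j k p) := by
  classical
  rw [Polynomial.degreeLE_eq_span_X_pow] at hp
  refine LinearMap.eqOn_span (f := (weightedHomogenization R c d j k).comp (Polynomial.taylor s))
    (g := f.toLinearMap.comp (weightedHomogenization R c d j k)) ?_ hp
  intro q hq
  simp only [Finset.coe_image, Finset.coe_range, Set.mem_image, Set.mem_Iio] at hq
  obtain ⟨m, hm, rfl⟩ := hq
  have hmc : m ≤ c := Nat.le_of_lt_succ hm
  have h1 : weightedHomogenization R c d j k (Polynomial.X ^ m) =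
      MvPolynomial.X j ^ m * MvPolynomial.X k ^ (d * (c - m)) := by
    rw [Polynomial.X_pow_eq_monomial, weightedHomogenization_monomial hmc, one_smul]
  have h2 : Polynomial.taylor s (Polynomial.X ^ m) =
      (Polynomial.X + Polynomial.C s) ^ m := by simp
  simp only [LinearMap.comp_apply, AlgHom.toLinearMap_apply]
  rw [h1, h2, weightedHomogenization_apply, map_mul, map_pow, map_pow, hj, hk,
    add_pow (MvPolynomial.X j), Finset.sum_mul]
  symm
  refine Finset.sum_subset_zero_on_sdiff (Finset.range_mono (by omega)) ?_ ?_
  · intro t ht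
    simp only [Finset.mem_sdiff, Finset.mem_range] at ht
    rw [Polynomial.coeff_X_add_C_pow, Nat.choose_eq_zero_of_lt (by omega)]
    simp
  · intro t ht
    rw [Finset.mem_range] at ht
    have he : d * (c - t) = d * (m - t) + d * (c - m) := by
      rw [← mul_add]; congr 1; omega
    rw [Polynomial.coeff_X_add_C_pow, he, MvPolynomial.smul_eq_C_mul]
    simp only [map_mul, map_pow, map_natCast]
    ring

end weightedHomogenization

/-- The endomorphism `x_i ↦ x_i + f` fixing the other variables. -/
noncomputable def addToVar {R : Type} [CommRing R] {n : ℕ} (i : Fin n)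
    (f : MvPolynomial (Fin n) R) : MvPolynomial (Fin n) R →ₐ[R] MvPolynomial (Fin n) R :=
  MvPolynomial.aeval fun l => if l = i then MvPolynomial.X i + f else MvPolynomial.X l

section addToVar

variable {R : Type} [CommRing R] {n : ℕ} {i l : Fin n}

theorem addToVar_X_self (f : MvPolynomial (Fin n) R) :
    addToVar i f (MvPolynomial.X i) = MvPolynomial.X i + f := by
  simp [addToVar]

theorem addToVar_X_of_ne (f : MvPolynomial (Fin n) R) (h : l ≠ i) :
    addToVar i f (MvPolynomial.X l) = MvPolynomial.X l := by
  simp [addToVar, h]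

theorem addToVar_zero : addToVar i (0 : MvPolynomial (Fin n) R) = AlgHom.id R _ := by
  apply MvPolynomial.algHom_ext
  intro l
  by_cases h : l = i <;> simp [addToVar, h]

theorem addToVar_comp {f g : MvPolynomial (Fin n) R} (hg : addToVar i f g = g) :
    (addToVar i f).comp (addToVar i g) = addToVar i (f + g) := by
  apply MvPolynomial.algHom_ext
  intro l
  by_cases h : l = i
  · subst h
    simp [addToVar_X_self, hg, add_assoc]
  · simp [addToVar_X_of_ne _ h]

end addToVar

/-- The action of `R[x]_{≤ c}` by `x_i ↦ x_i + x_k^{dc} P(x_j / x_k^d)`. -/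
noncomputable def polynomialPartHom (R : Type) [CommRing R] {n : ℕ} (c d : ℕ) {i j k : Fin n}
    (hji : j ≠ i) (hki : k ≠ i) :
    Multiplicative (Polynomial.degreeLE R c) →*
      (MvPolynomial (Fin n) R ≃ₐ[R] MvPolynomial (Fin n) R) :=
  have fixed : ∀ (f : MvPolynomial (Fin n) R) (p : Polynomial R),
      addToVar i f (weightedHomogenization R c d j k p) = weightedHomogenization R c d j k p :=
    fun f p => map_weightedHomogenization_of_fixed _ (addToVar_X_of_ne f hji)
      (addToVar_X_of_ne f hki) p
  { toFun := fun p => AlgEquiv.ofAlgHom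
      (addToVar i (weightedHomogenization R c d j k (p.toAdd : Polynomial R)))
      (addToVar i (weightedHomogenization R c d j k (-(p.toAdd : Polynomial R))))
      (by rw [addToVar_comp (fixed _ _), map_neg, add_neg_cancel, addToVar_zero])
      (by rw [addToVar_comp (fixed _ _), map_neg, neg_add_cancel, addToVar_zero])
    map_one' := AlgEquiv.ext fun q => by
      change addToVar i (weightedHomogenization R c d j k (0 : Polynomial R)) q = q
      rw [map_zero, addToVar_zero, AlgHom.id_apply]
    map_mul' := fun p q => AlgEquiv.ext fun a => by
      change addToVar i (weightedHomogenization R c d j k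
        ((p.toAdd : Polynomial R) + (q.toAdd : Polynomial R))) a =
          ((addToVar i (weightedHomogenization R c d j k (p.toAdd : Polynomial R))).comp
            (addToVar i (weightedHomogenization R c d j k (q.toAdd : Polynomial R)))) a
      rw [addToVar_comp (fixed _ _), map_add] }

theorem polynomialPartHom_apply {R : Type} [CommRing R] {n c d : ℕ} {i j k : Fin n}
    (hji : j ≠ i) (hki : k ≠ i) (p : Multiplicative (Polynomial.degreeLE R c))
    (q : MvPolynomial (Fin n) R) :
    polynomialPartHom R c d hji hki p q =
      addToVar i (weightedHomogenization R c d j k (p.toAdd : Polynomial R)) q :=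
  rfl

theorem transvection_apply {R : Type} [CommRing R] {n : ℕ} {i j : Fin n} (hji : j ≠ i) (e : ℕ)
    (r : R) (q : MvPolynomial (Fin n) R) :
    transvection R n i j hji e r q =
      addToVar i (MvPolynomial.C r * MvPolynomial.X j ^ e) q :=
  rfl

theorem biTransvection_apply {R : Type} [CommRing R] {n : ℕ} {i j k : Fin n} (hji : j ≠ i)
    (hki : k ≠ i) (a b : ℕ) (r : R) (q : MvPolynomial (Fin n) R) :
    biTransvection R n i j k hji hki a b r q =
      addToVar i (MvPolynomial.C r * MvPolynomial.X j ^ a * MvPolynomial.X k ^ b) q :=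
  rfl

/-- The transvections `α_{j;k}^{(d)}(s)` as a homomorphism in `s`. -/
noncomputable def transvectionHom (R : Type) [CommRing R] {n : ℕ} (d : ℕ) {j k : Fin n}
    (hkj : k ≠ j) :
    Multiplicative R →* (MvPolynomial (Fin n) R ≃ₐ[R] MvPolynomial (Fin n) R) where
  toFun s := transvection R n j k hkj d s.toAdd
  map_one' := AlgEquiv.ext fun q => by
    rw [transvection_apply, toAdd_one, map_zero, zero_mul, addToVar_zero]
    rfl
  map_mul' s t := AlgEquiv.ext fun q => by
    rw [AlgEquiv.mul_apply]
    simp only [transvection_apply]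
    rw [← AlgHom.comp_apply, addToVar_comp, toAdd_mul, map_add, add_mul]
    rw [map_mul, map_pow, addToVar_X_of_ne _ hkj, MvPolynomial.algHom_C]
    rfl

theorem polynomialPartHom_conj {R : Type} [CommRing R] {n c d : ℕ} {i j k : Fin n}
    (hji : j ≠ i) (hki : k ≠ i) (hkj : k ≠ j) (s : Multiplicative R)
    (p : Multiplicative (Polynomial.degreeLE R c)) :
    polynomialPartHom R c d hji hki (gammaPhi R c s p) * transvectionHom R d hkj s =
      transvectionHom R d hkj s * polynomialPartHom R c d hji hki p := by
  set z : MvPolynomial (Fin n) R := MvPolynomial.C s.toAdd * MvPolynomial.X k ^ d with hz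
  set f := weightedHomogenization R c d j k (p.toAdd : Polynomial R) with hf
  have hfs : weightedHomogenization R c d j k ((gammaPhi R c s p).toAdd : Polynomial R) =
      addToVar j z f :=
    weightedHomogenization_taylor (addToVar j z) s.toAdd (addToVar_X_self z)
      (addToVar_X_of_ne z hkj) p.toAdd.2
  have hcomm : (addToVar i (addToVar j z f)).comp (addToVar j z) =
      (addToVar j z).comp (addToVar i f) := by
    apply MvPolynomial.algHom_ext
    intro l
    simp only [AlgHom.comp_apply]
    by_cases h : l = i
    · subst h
      rw [addToVar_X_of_ne z hji.symm, addToVar_X_self, addToVar_X_self, map_add,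
        addToVar_X_of_ne z hji.symm]
    · rw [addToVar_X_of_ne f h]
      by_cases h' : l = j
      · subst h'
        have hzi : addToVar i (addToVar l z f) z = z := by
          rw [hz, map_mul, map_pow, addToVar_X_of_ne _ hki, MvPolynomial.algHom_C]
          rfl
        rw [addToVar_X_self, map_add, addToVar_X_of_ne _ h, hzi]
      · rw [addToVar_X_of_ne z h', addToVar_X_of_ne _ h]
  refine AlgEquiv.ext fun q => ?_
  rw [AlgEquiv.mul_apply, AlgEquiv.mul_apply, polynomialPartHom_apply, polynomialPartHom_apply,
    hfs]
  exact DFunLike.congr_fun hcomm q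

/-- The action of `Γ_{c,R}` on `R[x_1,…,x_n]` in which `P ∈ R[x]_{≤ c}` acts by
`x_i ↦ x_i + x_k^{dc} P(x_j / x_k^d)` and `y(s)` acts by `x_j ↦ x_j + s·x_k^d`. -/
noncomputable def gammaHom (R : Type) [CommRing R] {n : ℕ} (c d : ℕ) {i j k : Fin n}
    (hji : j ≠ i) (hki : k ≠ i) (hkj : k ≠ j) :
    GammaGroup R c →* (MvPolynomial (Fin n) R ≃ₐ[R] MvPolynomial (Fin n) R) :=
  SemidirectProduct.lift (φ := gammaPhi R c) (polynomialPartHom R c d hji hki)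
    (transvectionHom R d hkj) fun s => by
      refine MonoidHom.ext fun p => ?_
      rw [MonoidHom.comp_apply, MonoidHom.comp_apply, MulEquiv.coe_toMonoidHom,
        MulEquiv.coe_toMonoidHom, MulAut.conj_apply]
      exact eq_mul_inv_of_mul_eq (polynomialPartHom_conj hji hki hkj s p)

section gammaHom

variable {R : Type} [CommRing R] {n c d : ℕ} {i j k : Fin n}
  (hji : j ≠ i) (hki : k ≠ i) (hkj : k ≠ j)

theorem gammaHom_inl (p : Multiplicative (Polynomial.degreeLE R c)) :
    gammaHom R c d hji hki hkj (SemidirectProduct.inl (φ := gammaPhi R c) p) =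
      polynomialPartHom R c d hji hki p :=
  SemidirectProduct.lift_inl _ _ _ p

theorem gammaHom_inr (s : Multiplicative R) :
    gammaHom R c d hji hki hkj (SemidirectProduct.inr (φ := gammaPhi R c) s) =
      transvectionHom R d hkj s :=
  SemidirectProduct.lift_inr _ _ _ s

theorem gammaHom_apply (g : GammaGroup R c) :
    gammaHom R c d hji hki hkj g =
      polynomialPartHom R c d hji hki (SemidirectProduct.left g) *
        transvectionHom R d hkj (SemidirectProduct.right g) :=
  rfl

theorem gammaHom_injective : Function.Injective (gammaHom R c d hji hki hkj) := by
  rw [injective_iff_map_eq_one]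
  rintro ⟨p, s⟩ hg
  replace hg : polynomialPartHom R c d hji hki p * transvectionHom R d hkj s = 1 := hg
  have hs : (MvPolynomial.C s.toAdd * MvPolynomial.X k ^ d : MvPolynomial (Fin n) R) = 0 := by
    have h := DFunLike.congr_fun hg (MvPolynomial.X j)
    rw [AlgEquiv.mul_apply] at h
    change polynomialPartHom R c d hji hki p
      (addToVar j (MvPolynomial.C s.toAdd * MvPolynomial.X k ^ d) (MvPolynomial.X j)) =
        MvPolynomial.X j at h
    rw [addToVar_X_self, polynomialPartHom_apply, map_add, addToVar_X_of_ne _ hji, map_mul,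
      map_pow, addToVar_X_of_ne _ hki, MvPolynomial.algHom_C] at h
    exact add_eq_left.1 h
  have hp : weightedHomogenization R c d j k (p.toAdd : Polynomial R) = 0 := by
    have h := DFunLike.congr_fun hg (MvPolynomial.X i)
    rw [AlgEquiv.mul_apply] at h
    change polynomialPartHom R c d hji hki p
      (addToVar j (MvPolynomial.C s.toAdd * MvPolynomial.X k ^ d) (MvPolynomial.X i)) =
        MvPolynomial.X i at h
    rw [addToVar_X_of_ne _ hji.symm, polynomialPartHom_apply, addToVar_X_self] at h
    exact add_eq_left.1 h
  have hs' : s.toAdd = 0 := by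
    simpa using congrArg (MvPolynomial.eval fun _ => (1 : R)) hs
  have hp' : (p.toAdd : Polynomial R) = 0 := by
    rw [← aeval_weightedHomogenization (d := d) hkj.symm p.toAdd.2, hp, map_zero]
  exact SemidirectProduct.ext (Multiplicative.toAdd.injective (Subtype.ext hp'))
    (Multiplicative.toAdd.injective hs')

theorem gammaHom_inl_monoHom (r : R) {l : ℕ} (hl : l ≤ c) :
    gammaHom R c d hji hki hkj (SemidirectProduct.inl (φ := gammaPhi R c)
        (Multiplicative.ofAdd (monoHom R c l r))) =
      biTransvection R n i j k hji hki (c - l) (d * l) r := by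
  refine AlgEquiv.ext fun q => ?_
  rw [gammaHom_inl, polynomialPartHom_apply, biTransvection_apply, toAdd_ofAdd]
  change addToVar i (weightedHomogenization R c d j k (Polynomial.monomial (c - l) r)) q = _
  rw [weightedHomogenization_monomial (Nat.sub_le c l), Nat.sub_sub_self hl,
    MvPolynomial.smul_eq_C_mul, mul_assoc]

theorem biTransvection_zero_right (e : ℕ) (r : R) :
    biTransvection R n i j k hji hki e 0 r = transvection R n i j hji e r := by
  refine AlgEquiv.ext fun q => ?_
  rw [biTransvection_apply, transvection_apply, pow_zero, mul_one]

/-- If `c!` is invertible, the image of `Γ_{c,R}` is generated by transvections. -/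
theorem range_gammaHom_eq_closure (hc : IsUnit (c.factorial : R)) :
    (gammaHom R c d hji hki hkj).range =
      Subgroup.closure ({g | ∃ r : R, g = transvection R n i j hji c r} ∪
        {g | ∃ s : R, g = transvection R n j k hkj d s}) := by
  apply le_antisymm
  · set K := Subgroup.closure ({g | ∃ r : R, g = transvection R n i j hji c r} ∪
        {g | ∃ s : R, g = transvection R n j k hkj d s}) with hK
    have hY : ∀ s, transvectionHom R d hkj s ∈ K := fun s =>
      Subgroup.subset_closure (Or.inr ⟨s.toAdd, rfl⟩)
    let N : AddSubgroup (Polynomial R) :=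
      (Subgroup.toAddSubgroup' (K.comap (polynomialPartHom R c d hji hki))).map
        (Polynomial.degreeLE R c).subtype.toAddMonoidHom
    have hN : ∀ p : Polynomial.degreeLE R c, (p : Polynomial R) ∈ N ↔
        polynomialPartHom R c d hji hki (Multiplicative.ofAdd p) ∈ K := by
      intro p
      constructor
      · rintro ⟨q, hq, hqp⟩
        obtain rfl : q = p := Subtype.ext hqp
        exact hq
      · exact fun h => ⟨p, h, rfl⟩
    have hall := Polynomial.mem_of_taylor_one_mem hc N
      (fun r => (hN (monoHom R c 0 r)).2 (by
        rw [← gammaHom_inl hji hki hkj, gammaHom_inl_monoHom hji hki hkj r (Nat.zero_le c),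
          Nat.mul_zero, Nat.sub_zero, biTransvection_zero_right]
        exact Subgroup.subset_closure (Or.inl ⟨r, rfl⟩)))
      (by
        rintro _ ⟨p, hp, rfl⟩
        refine (hN (taylorShift R c 1 p)).2 ?_
        have h := polynomialPartHom_conj (d := d) hji hki hkj (Multiplicative.ofAdd 1)
          (Multiplicative.ofAdd p)
        have h' := eq_mul_inv_of_mul_eq h
        change polynomialPartHom R c d hji hki
          (gammaPhi R c (Multiplicative.ofAdd 1) (Multiplicative.ofAdd p)) ∈ K
        rw [h']
        exact K.mul_mem (K.mul_mem (hY _) hp) (K.inv_mem (hY _)))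
    rintro _ ⟨g, rfl⟩
    rw [gammaHom_apply]
    refine K.mul_mem ?_ (hY _)
    refine (hN (SemidirectProduct.left g).toAdd).1 (hall _ ?_)
    exact Polynomial.natDegree_le_iff_degree_le.2
      (Polynomial.mem_degreeLE.1 (SemidirectProduct.left g).toAdd.2)
  · rw [Subgroup.closure_le]
    rintro _ (⟨r, rfl⟩ | ⟨s, rfl⟩)
    · refine ⟨_, (gammaHom_inl_monoHom hji hki hkj r (Nat.zero_le c)).trans ?_⟩
      rw [Nat.mul_zero, Nat.sub_zero, biTransvection_zero_right]
    · exact ⟨_, gammaHom_inr hji hki hkj (Multiplicative.ofAdd s)⟩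

end gammaHom

/-- Let `R` be a commutative ring, `n ≥ 3`, `c ≥ 1`, `d ≥ 0`, and let
`i, j, k` be pairwise distinct indices.  Then there is an injective group homomorphism
`ψ : Γ_{c,R} → Aut(R[x_1,…,x_n])` with `ψ(r·x^{c-ℓ}) = β_{i;j,k}^{(c-ℓ, dℓ)}(r)` and
`ψ(y(s)) = α_{j;k}^{(d)}(s)`.  In particular, if `c!` is invertible in `R`, the
subgroup generated by `{α_{i;j}^{(c)}(r)} ∪ {α_{j;k}^{(d)}(s)}` is isomorphic to
`Γ_{c,R}` and contains `β_{i;j,k}^{(c-ℓ, dℓ)}(r)` for all `r ∈ R`, `0 ≤ ℓ ≤ c`. -/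
theorem stmt8 (R : Type) [CommRing R] (n : ℕ) (hn : 3 ≤ n) (c d : ℕ) (hc : 1 ≤ c)
    (i j k : Fin n) (hij : i ≠ j) (hjk : j ≠ k) (hik : i ≠ k) :
    (∃ ψ : GammaGroup R c →*
        (MvPolynomial (Fin n) R ≃ₐ[R] MvPolynomial (Fin n) R),
      Function.Injective ψ ∧
      (∀ (r : R) (l : ℕ), l ≤ c →
        ψ (SemidirectProduct.inl (φ := gammaPhi R c)
            (Multiplicative.ofAdd (monoHom R c l r))) =
          biTransvection R n i j k hij.symm hik.symm (c - l) (d * l) r) ∧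
      (∀ s : R,
        ψ (SemidirectProduct.inr (φ := gammaPhi R c) (Multiplicative.ofAdd s)) =
          transvection R n j k hjk.symm d s)) ∧
    (IsUnit (c.factorial : R) →
      (Nonempty
        ((Subgroup.closure
          ({g | ∃ r : R, g = transvection R n i j hij.symm c r} ∪
           {g | ∃ s : R, g = transvection R n j k hjk.symm d s})) ≃* GammaGroup R c)) ∧
      (∀ (r : R) (l : ℕ), l ≤ c →
        biTransvection R n i j k hij.symm hik.symm (c - l) (d * l) r ∈
          Subgroup.closure
            ({g | ∃ r : R, g = transvection R n i j hij.symm c r} ∪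
             {g | ∃ s : R, g = transvection R n j k hjk.symm d s}))) := by
  refine ⟨⟨gammaHom R c d hij.symm hik.symm hjk.symm, gammaHom_injective _ _ _,
    fun r l hl => gammaHom_inl_monoHom _ _ _ r hl, fun s => gammaHom_inr _ _ _ _⟩, fun hu => ?_⟩
  rw [← range_gammaHom_eq_closure hij.symm hik.symm hjk.symm hu]
  exact ⟨⟨(MonoidHom.ofInjective (gammaHom_injective hij.symm hik.symm hjk.symm)).symm⟩,
    fun r l hl => ⟨_, gammaHom_inl_monoHom hij.symm hik.symm hjk.symm r hl⟩⟩
end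

section
/- For every prime p and every n ≥ 1, the group Aut(F_p[x_1,…,x_n]) of F_p-algebra automorphisms of the polynomial ring F_p[x_1,…,x_n] is residually finite: for every automorphism g ≠ id there exist a finite group F and a group homomorphism φ : Aut(F_p[x_1,…,x_n]) → F with φ(g) ≠ 1. -/
/-- A nonzero polynomial over a field has a non-root with coordinates in any finite extension
field with more elements than the total degree of the polynomial. -/
theorem MvPolynomial.exists_aeval_ne_zero_of_totalDegree_lt_card {F K σ : Type*} [Field F]
    [Field K] [Fintype K] [Algebra F K] [Finite σ] {P : MvPolynomial σ F} (hP : P ≠ 0)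
    (hcard : P.totalDegree < Fintype.card K) :
    ∃ x : σ → K, MvPolynomial.aeval x P ≠ 0 := by
  by_contra! h
  have hdeg : (MvPolynomial.map (algebraMap F K) P).totalDegree ≤ P.totalDegree :=
    Finset.sup_mono (MvPolynomial.support_map_subset _ P)
  have hmap : MvPolynomial.map (algebraMap F K) P = 0 := by
    refine MvPolynomial.eq_zero_of_eval_zero_at_prod_finset _ (fun _ => Finset.univ)
      (fun i => ?_) fun x _ => ?_
    · rw [Finset.card_univ]
      exact ((MvPolynomial.degreeOf_le_totalDegree _ i).trans hdeg).trans_lt hcard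
    · rw [MvPolynomial.eval_map, ← MvPolynomial.aeval_def]
      exact h x
  exact hP (MvPolynomial.map_injective _ (algebraMap F K).injective
    (hmap.trans (map_zero _).symm))

/-- Over `ZMod p`, a nonzero polynomial has a non-root with coordinates in some finite field. -/
theorem MvPolynomial.exists_aeval_galoisField_ne_zero (p : ℕ) [Fact p.Prime] {σ : Type*} [Finite σ]
    {P : MvPolynomial σ (ZMod p)} (hP : P ≠ 0) :
    ∃ (k : ℕ) (x : σ → GaloisField p k), MvPolynomial.aeval x P ≠ 0 := by
  refine ⟨P.totalDegree + 1, ?_⟩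
  have : Fintype (GaloisField p (P.totalDegree + 1)) := Fintype.ofFinite _
  refine MvPolynomial.exists_aeval_ne_zero_of_totalDegree_lt_card hP ?_
  rw [← Nat.card_eq_fintype_card, GaloisField.card p _ P.totalDegree.succ_ne_zero]
  exact P.totalDegree.lt_succ_self.trans (Nat.lt_pow_self (Fact.out : p.Prime).one_lt)

/-- The action of the automorphism group of an algebra `A` on the `B`-points of `A`. -/
def AlgEquiv.permAlgHom (R A B : Type*) [CommSemiring R] [Semiring A] [Semiring B]
    [Algebra R A] [Algebra R B] : (A ≃ₐ[R] A) →* Equiv.Perm (A →ₐ[R] B) where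
  toFun g :=
    { toFun := fun f => f.comp (g.symm : A →ₐ[R] A)
      invFun := fun f => f.comp (g : A →ₐ[R] A)
      left_inv := fun f => by ext; simp
      right_inv := fun f => by ext; simp }
  map_one' := rfl
  map_mul' _ _ := rfl

/-- For every prime `p` and every `n ≥ 1`, the group of
`F_p`-algebra automorphisms of `F_p[x_1, …, x_n]` is residually finite: for every
automorphism `g ≠ 1` there exist a finite group `F` and a group homomorphism `φ` from
the automorphism group to `F` with `φ g ≠ 1`. -/
theorem stmt12 (p : ℕ) [Fact p.Prime] (n : ℕ) (hn : 1 ≤ n)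
    (g : MvPolynomial (Fin n) (ZMod p) ≃ₐ[ZMod p] MvPolynomial (Fin n) (ZMod p))
    (hg : g ≠ 1) :
    ∃ (F : Type) (_ : Group F) (_ : Finite F)
      (φ : (MvPolynomial (Fin n) (ZMod p) ≃ₐ[ZMod p] MvPolynomial (Fin n) (ZMod p)) →* F),
      φ g ≠ 1 := by
  obtain ⟨i, hi⟩ : ∃ i, g (MvPolynomial.X i) ≠ MvPolynomial.X i := by
    by_contra! h
    refine hg (AlgEquiv.ext fun q => ?_)
    exact DFunLike.congr_fun (MvPolynomial.algHom_ext
      (f := (g : MvPolynomial (Fin n) (ZMod p) →ₐ[ZMod p] MvPolynomial (Fin n) (ZMod p)))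
      (g := AlgHom.id _ _) h) q
  obtain ⟨k, x, hx⟩ := MvPolynomial.exists_aeval_galoisField_ne_zero p (sub_ne_zero.mpr hi)
  have : Finite (MvPolynomial (Fin n) (ZMod p) →ₐ[ZMod p] GaloisField p k) :=
    Finite.of_injective (fun f j => f (MvPolynomial.X j))
      fun _ _ h => MvPolynomial.algHom_ext (congrFun h)
  refine ⟨Equiv.Perm (MvPolynomial (Fin n) (ZMod p) →ₐ[ZMod p] GaloisField p k), inferInstance,
    inferInstance, AlgEquiv.permAlgHom _ _ _, fun h => hx ?_⟩
  have hfix : (MvPolynomial.aeval x).comp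
      (g.symm : MvPolynomial (Fin n) (ZMod p) →ₐ[ZMod p] MvPolynomial (Fin n) (ZMod p)) =
      MvPolynomial.aeval x := DFunLike.congr_fun h (MvPolynomial.aeval x)
  have hgX := DFunLike.congr_fun hfix (g (MvPolynomial.X i))
  rw [map_sub, ← hgX]
  simp
end

section
/- Let p be an odd prime. The three permutations of the set F_p^3 ∖ {(0,0,0)} (of cardinality p^3 − 1) given by σ(x,y,z) = (y,z,x), α(x,y,z) = (x+y, y, z) and β(x,y,z) = (x+y², y, z) generate the full alternating group Alt(F_p^3 ∖ {(0,0,0)}). -/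
/-- The permutation adding `g (v (i + 1)) (v (i + 2))` to the `i`-th coordinate of `v`. -/
def shear {R : Type*} [AddGroup R] (i : Fin 3) (g : R → R → R) : Equiv.Perm (Fin 3 → R) where
  toFun v := Function.update v i (v i + g (v (i + 1)) (v (i + 2)))
  invFun v := Function.update v i (v i - g (v (i + 1)) (v (i + 2)))
  left_inv v := by
    funext j
    fin_cases i <;> fin_cases j <;> simp
  right_inv v := by
    funext j
    fin_cases i <;> fin_cases j <;> simp

theorem shear_apply {R : Type*} [AddGroup R] (i : Fin 3) (g : R → R → R) (v : Fin 3 → R) :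
    shear i g v = Function.update v i (v i + g (v (i + 1)) (v (i + 2))) := rfl

theorem shear_zero {R : Type*} [AddGroup R] (i : Fin 3) : shear i (0 : R → R → R) = 1 := by
  ext v : 1
  simp [shear_apply]

section CommRing

variable {R : Type*} [CommRing R]

theorem shear_add (i : Fin 3) (g g' : R → R → R) :
    shear i (g + g') = shear i g * shear i g' := by
  ext v j
  fin_cases i <;> fin_cases j <;> simp [shear_apply] <;> ring

theorem shear_neg (i : Fin 3) (g : R → R → R) : shear i (-g) = (shear i g)⁻¹ := by
  rw [eq_inv_iff_mul_eq_one, ← shear_add, neg_add_cancel, shear_zero]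

theorem shear_nsmul (i : Fin 3) (g : R → R → R) (n : ℕ) : shear i (n • g) = shear i g ^ n := by
  induction n with
  | zero => simp [shear_zero]
  | succ n ih => rw [succ_nsmul, shear_add, ih, pow_succ]

theorem shear_subst_left (i : Fin 3) (g : R → R → R) (h : R → R) :
    shear i (fun y z ↦ g (y + h z) z) =
      (shear (i + 1) fun u _ ↦ h u)⁻¹ * shear i g * shear (i + 1) fun u _ ↦ h u := by
  rw [mul_assoc, eq_inv_mul_iff_mul_eq]
  ext v j
  fin_cases i <;> fin_cases j <;> simp [shear_apply]

theorem shear_subst_right (i : Fin 3) (g : R → R → R) (h : R → R) :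
    shear i (fun y z ↦ g y (z + h y)) =
      (shear (i + 2) fun _ v ↦ h v)⁻¹ * shear i g * shear (i + 2) fun _ v ↦ h v := by
  rw [mul_assoc, eq_inv_mul_iff_mul_eq]
  ext v j
  fin_cases i <;> fin_cases j <;> simp [shear_apply]

theorem shear_rotate {σ : Equiv.Perm (Fin 3 → R)} (hσ : ∀ v (i : Fin 3), σ v i = v (i + 1))
    (i : Fin 3) (g : R → R → R) : shear i g = σ * shear (i + 1) g * σ⁻¹ := by
  rw [eq_mul_inv_iff_mul_eq]
  ext v j
  fin_cases i <;> fin_cases j <;> simp [shear_apply, hσ]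

end CommRing

section ZMod

variable {p : ℕ}

/-- The functions `g` all of whose shears `shear i g` belong to `H`. -/
def shearSubmodule (H : Subgroup (Equiv.Perm (Fin 3 → ZMod p))) :
    Submodule (ZMod p) (ZMod p → ZMod p → ZMod p) :=
  AddSubgroup.toZModSubmodule p
    { carrier := {g | ∀ i, shear i g ∈ H}
      zero_mem' := fun i ↦ by rw [shear_zero]; exact H.one_mem
      add_mem' := fun hg hg' i ↦ by rw [shear_add]; exact H.mul_mem (hg i) (hg' i)
      neg_mem' := fun hg i ↦ by rw [shear_neg]; exact H.inv_mem (hg i) }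

variable {H : Subgroup (Equiv.Perm (Fin 3 → ZMod p))}

theorem mem_shearSubmodule {g : ZMod p → ZMod p → ZMod p} :
    g ∈ shearSubmodule H ↔ ∀ i, shear i g ∈ H := Iff.rfl

theorem mem_shearSubmodule_of_rotate_mem {σ : Equiv.Perm (Fin 3 → ZMod p)}
    (hσ : ∀ v (i : Fin 3), σ v i = v (i + 1)) (hσH : σ ∈ H) {g : ZMod p → ZMod p → ZMod p}
    (hg : shear 0 g ∈ H) : g ∈ shearSubmodule H := by
  have step (i : Fin 3) (hi : shear (i + 1) g ∈ H) : shear i g ∈ H := by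
    rw [shear_rotate hσ]
    exact H.mul_mem (H.mul_mem hσH hi) (H.inv_mem hσH)
  have h2 : shear 2 g ∈ H := step 2 hg
  have h1 : shear 1 g ∈ H := step 1 h2
  rw [mem_shearSubmodule]
  intro i
  fin_cases i <;> assumption

theorem subst_left_mem_shearSubmodule {g : ZMod p → ZMod p → ZMod p} {h : ZMod p → ZMod p}
    (hg : g ∈ shearSubmodule H) (hh : (fun u _ ↦ h u) ∈ shearSubmodule H) :
    (fun y z ↦ g (y + h z) z) ∈ shearSubmodule H := fun i ↦ by
  rw [shear_subst_left]
  exact H.mul_mem (H.mul_mem (H.inv_mem (hh _)) (hg i)) (hh _)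

theorem subst_right_mem_shearSubmodule {g : ZMod p → ZMod p → ZMod p} {h : ZMod p → ZMod p}
    (hg : g ∈ shearSubmodule H) (hh : (fun _ v ↦ h v) ∈ shearSubmodule H) :
    (fun y z ↦ g y (z + h y)) ∈ shearSubmodule H := fun i ↦ by
  rw [shear_subst_right]
  exact H.mul_mem (H.mul_mem (H.inv_mem (hh _)) (hg i)) (hh _)

variable [Fact p.Prime]

theorem exists_polynomial_eval_eq (h : ZMod p → ZMod p) :
    ∃ Q : Polynomial (ZMod p), ∀ x, Q.eval x = h x :=
  ⟨Lagrange.interpolate Finset.univ id h, fun x ↦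
    Lagrange.eval_interpolate_at_node h Function.injective_id.injOn (Finset.mem_univ x)⟩

theorem oneVar_mem_shearSubmodule (h2 : (2 : ZMod p) ≠ 0)
    (hlin : (fun y _ ↦ y) ∈ shearSubmodule H) (hsq : (fun y _ ↦ y ^ 2) ∈ shearSubmodule H)
    {h : ZMod p → ZMod p} (h0 : h 0 = 0) :
    (fun y _ ↦ h y) ∈ shearSubmodule H ∧ (fun _ z ↦ h z) ∈ shearSubmodule H := by
  have hlin' : (fun _ z ↦ z) ∈ shearSubmodule H := by
    convert! (shearSubmodule H).sub_mem (subst_left_mem_shearSubmodule hlin hlin) hlin using 1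
    ext y z
    simp
  have hadd := subst_left_mem_shearSubmodule hsq hlin
  have hsub := subst_left_mem_shearSubmodule (h := fun u ↦ -u) hsq
    ((shearSubmodule H).neg_mem hlin)
  have hmul : (fun y z ↦ y * z) ∈ shearSubmodule H := by
    convert! (shearSubmodule H).smul_mem ((2 : ZMod p)⁻¹ * 2⁻¹)
      ((shearSubmodule H).sub_mem hadd hsub) using 1
    ext y z
    simp only [Pi.smul_apply, Pi.sub_apply, smul_eq_mul]
    field_simp
    ring
  have key (Q : Polynomial (ZMod p)) : (fun y _ ↦ y * Q.eval y) ∈ shearSubmodule H ∧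
      (fun _ z ↦ z * Q.eval z) ∈ shearSubmodule H := by
    induction Q using Polynomial.induction_on with
    | C c =>
      constructor
      · convert! (shearSubmodule H).smul_mem c hlin using 1
        ext y z
        simp [mul_comm]
      · convert! (shearSubmodule H).smul_mem c hlin' using 1
        ext y z
        simp [mul_comm]
    | add Q Q' hQ hQ' =>
      simp only [Polynomial.eval_add, mul_add]
      exact ⟨(shearSubmodule H).add_mem hQ.1 hQ'.1, (shearSubmodule H).add_mem hQ.2 hQ'.2⟩
    | monomial n c ih =>
      constructor
      · convert! (shearSubmodule H).sub_mem (subst_right_mem_shearSubmodule hmul ih.2) hmul using 1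
        ext y z
        simp
        ring
      · convert! (shearSubmodule H).sub_mem (subst_left_mem_shearSubmodule hmul ih.1) hmul using 1
        ext y z
        simp
        ring
  obtain ⟨Q, hQ⟩ := exists_polynomial_eval_eq fun x ↦ x⁻¹ * h x
  have hQh (x : ZMod p) : x * Q.eval x = h x := by
    rw [hQ]
    by_cases hx : x = 0
    · simp [hx, h0]
    · field_simp
  simpa only [hQh] using key Q

/-- `H` contains two permutations whose supports meet exactly in `(1, 1, 1)`. -/
theorem exists_mem_support_inter_eq (h2 : (2 : ZMod p) ≠ 0)
    (hlin : (fun y _ ↦ y) ∈ shearSubmodule H) (hsq : (fun y _ ↦ y ^ 2) ∈ shearSubmodule H) :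
    ∃ f ∈ H, ∃ h ∈ H, f 1 = ![0, 1, 1] ∧ h 1 ≠ 1 ∧ ∀ v, f v ≠ v → h v ≠ v → v = 1 := by
  let δ (c x : ZMod p) : ZMod p := if x = c then 1 else 0
  have hδ {c : ZMod p} (hc : c ≠ 0) := oneVar_mem_shearSubmodule (h := δ c) h2 hlin hsq
    (if_neg hc.symm)
  have h21 : (2 : ZMod p) ≠ 1 := fun h ↦ one_ne_zero (α := ZMod p) (by linear_combination h)
  have hf : (fun y z ↦ δ 1 (z + δ 1 y) - δ 1 z) ∈ shearSubmodule H :=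
    (shearSubmodule H).sub_mem
      (subst_right_mem_shearSubmodule (hδ one_ne_zero).2 (hδ one_ne_zero).2) (hδ one_ne_zero).2
  have hh : (fun y z ↦ δ 2 (y + δ 1 z) - δ 2 y) ∈ shearSubmodule H :=
    (shearSubmodule H).sub_mem
      (subst_left_mem_shearSubmodule (hδ h2).1 (hδ one_ne_zero).1) (hδ h2).1
  refine ⟨_, hf 0, _, hh 1, ?_, ?_, fun v hfv hhv ↦ ?_⟩
  · ext j
    fin_cases j <;> simp [shear_apply, δ, one_add_one_eq_two, h21]
  · intro h
    exact h21 (by simpa [shear_apply, δ, one_add_one_eq_two, h21.symm] using congrFun h 1)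
  · have hy : v 1 = 1 := by
      by_contra hy
      simp [shear_apply, δ, hy] at hfv
    have hx : v 0 = 1 := by
      by_contra hx
      simp [shear_apply, δ, hx] at hhv
    have hz : v 2 = 1 := by
      simp only [shear_apply, δ, ne_eq, Function.update_eq_self_iff] at hfv hhv
      by_contra hz
      simp [hx, hy, hz] at hfv hhv
      grind
    ext j
    fin_cases j <;> assumption

/-- A partial equivalence relation invariant under all one-variable shears and the rotation, and relating
`(1, 1, 1)` to `(0, 1, 1)`, relates all nonzero vectors. -/
theorem rel_one_of_ne_zero {r : (Fin 3 → ZMod p) → (Fin 3 → ZMod p) → Prop}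
    (hsymm : ∀ {u v}, r u v → r v u) (htrans : ∀ {u v w}, r u v → r v w → r u w)
    {σ : Equiv.Perm (Fin 3 → ZMod p)} (hσ : ∀ v (i : Fin 3), σ v i = v (i + 1))
    (hrσ : ∀ u v, r u v → r (σ u) (σ v))
    (hr : ∀ (h : ZMod p → ZMod p) (i : Fin 3) (g : Equiv.Perm (Fin 3 → ZMod p)),
      h 0 = 0 → (g = shear i (fun y _ ↦ h y) ∨ g = shear i (fun _ z ↦ h z)) →
        ∀ u v, r u v → r (g u) (g v))
    (h01 : r 1 ![0, 1, 1]) {v : Fin 3 → ZMod p} (hv : v ≠ 0) : r 1 v := by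
  have hplane (v : Fin 3 → ZMod p) (hv : v 0 = 1) : r ![0, 1, 1] v := by
    have h1 := hr (Pi.single 1 (v 1 - 1)) 1 _ (by simp) (.inr rfl) _ _ h01
    have h2 := hr (Pi.single 1 (v 2 - 1)) 2 _ (by simp) (.inl rfl) _ _ h1
    convert! hsymm h2 using 1
    · ext j
      fin_cases j <;> simp [shear_apply]
    · ext j
      fin_cases j <;> simp [shear_apply, hv]
  have hplane₀ (v : Fin 3 → ZMod p) (hv : v 0 = 1) : r 1 v := htrans h01 (hplane v hv)
  have hσ1 : σ 1 = 1 := by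
    ext j
    simp [hσ]
  have hσr {v : Fin 3 → ZMod p} (h : r 1 v) : r 1 (σ v) := by
    simpa only [hσ1] using hrσ _ _ h
  have hσσ (v : Fin 3 → ZMod p) : σ (σ (σ v)) = v := by
    ext j
    fin_cases j <;> simp [hσ]
  have hplane₁ (v : Fin 3 → ZMod p) (hv : v 1 = 1) : r 1 v := by
    rw [← hσσ v]
    exact hσr (hσr (hplane₀ _ (by simp [hσ, hv])))
  have hy (v : Fin 3 → ZMod p) (hv : v 1 ≠ 0) : r 1 v := by
    by_cases h1 : v 1 = 1
    · exact hplane₁ v h1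
    have := hr (Pi.single (v 1) (v 0 - 1)) 0 _ (by simp [hv.symm]) (.inl rfl) _ _
      (hplane₀ ![1, v 1, v 2] rfl)
    convert! this using 1
    · ext j
      fin_cases j <;> simp [shear_apply, Ne.symm h1]
    · ext j
      fin_cases j <;> simp [shear_apply]
  obtain ⟨j, hj⟩ := Function.ne_iff.mp hv
  fin_cases j
  · rw [← hσσ v]
    exact hσr (hy _ (by simpa [hσ] using hj))
  · exact hy v hj
  · rw [← hσσ v]
    exact hσr (hσr (hy _ (by simpa [hσ] using hj)))

end ZMod

section Perm

open Equiv Equiv.Perm MulAction Pointwise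

variable {α : Type*}

/-- The commutator of two permutations that move exactly one common point `c` is the `3`-cycle
`c ↦ f c ↦ h c ↦ c`. -/
theorem commutator_eq_swap_mul_swap [DecidableEq α] {f h : Perm α} {c : α} (hf : f c ≠ c)
    (hh : h c ≠ c) (hfh : ∀ x, f x ≠ x → h x ≠ x → x = c) :
    f * h * f⁻¹ * h⁻¹ = swap c (f c) * swap (f c) (h c) := by
  have fixed_h {x : α} (hx : f x ≠ x) (hxc : x ≠ c) : h x = x := by
    by_contra hx'
    exact hxc (hfh x hx hx')
  have fixed_f {x : α} (hx : h x ≠ x) (hxc : x ≠ c) : f x = x := by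
    by_contra hx'
    exact hxc (hfh x hx' hx)
  have hfc : h (f c) = f c := fixed_h (fun H ↦ hf (f.injective H)) hf
  have hhc : f (h c) = h c := fixed_f (fun H ↦ hh (h.injective H)) hh
  have hne : f c ≠ h c := fun H ↦ hf (f.injective (by rw [H, hhc]))
  suffices f * h = swap c (f c) * swap (f c) (h c) * (h * f) by
    rw [this]
    group
  ext x
  simp only [Perm.mul_apply]
  by_cases hxc : x = c
  · subst hxc
    rw [hfc, swap_apply_left, swap_apply_of_ne_of_ne hh hne.symm, hhc]
  by_cases hx : f x = x
  · rw [hx]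
    by_cases hx' : h x = c
    · rw [hx', swap_apply_of_ne_of_ne hf.symm hh.symm, swap_apply_left]
    · have h1 : h x ≠ f c := fun H ↦ by
        have := h.injective (H.trans hfc.symm)
        subst this
        exact hf (f.injective hx)
      have h2 : h x ≠ h c := fun H ↦ hxc (h.injective H)
      rw [swap_apply_of_ne_of_ne h1 h2, swap_apply_of_ne_of_ne hx' h1]
      by_cases h3 : h x = x
      · rw [h3, hx]
      · exact fixed_f (fun H ↦ h3 (h.injective H)) hx'
  · rw [fixed_h hx hxc]
    by_cases hx' : f x = c
    · rw [hx', swap_apply_right, swap_apply_right]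
    · rw [fixed_h (fun H ↦ hx (f.injective H)) hx']
      have h1 : f x ≠ f c := fun H ↦ hxc (f.injective H)
      have h2 : f x ≠ h c := fun H ↦ hx <| by
        rw [← hhc] at H
        rw [f.injective H, hhc]
      rw [swap_apply_of_ne_of_ne h1 h2, swap_apply_of_ne_of_ne hx' h1]

/-- If `G` contains the `3`-cycle `a ↦ b ↦ c ↦ a` and every `G`-invariant equivalence relation that
identifies `a` with `b` is total, then `G` contains the alternating group. -/
theorem alternatingGroup_le_of_swap_mul_swap_mem [Fintype α] [DecidableEq α]
    {G : Subgroup (Perm α)} {a b c : α} (hab : a ≠ b) (hac : a ≠ c) (hbc : b ≠ c)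
    (hτ : swap a b * swap b c ∈ G)
    (htotal : ∀ r : Setoid α, (∀ g ∈ G, ∀ u v, r u v → r (g u) (g v)) → r a b → ∀ v, r a v) :
    alternatingGroup α ≤ G := by
  set τ := swap a b * swap b c with hτ_def
  have hτa : τ a = b := by simp [hτ_def, swap_apply_of_ne_of_ne hab hac]
  have hτc : τ c = a := by simp [hτ_def]
  have : IsPretransitive G α := by
    have horb := htotal (orbitRel G α) (fun g hg u v ↦ by
      rintro ⟨k, rfl⟩
      exact ⟨⟨g, hg⟩ * k * ⟨g, hg⟩⁻¹, by simp [mul_smul, Subgroup.smul_def]⟩)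
      (Setoid.symm' _ ⟨⟨τ, hτ⟩, hτa⟩)
    exact (isPretransitive_iff_base a).mpr fun v ↦ Setoid.symm' _ (horb v)
  have : IsPreprimitive G α := by
    refine IsPreprimitive.of_isTrivialBlock_base a fun {B} haB hB ↦ ?_
    by_cases hBs : B.Subsingleton
    · exact .inl hBs
    refine .inr (Set.eq_univ_of_forall fun v ↦ ?_)
    obtain ⟨x, hxB, hxa⟩ := (Set.not_subsingleton_iff.mp hBs).exists_ne a
    have hbB : b ∈ B := by
      by_cases hxb : x = b
      · exact hxb ▸ hxB
      have hτB : (⟨τ, hτ⟩ : G) • B = B := by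
        refine hB.smul_eq_of_mem hxB ?_
        change τ x ∈ B
        by_cases hxc : x = c
        · rwa [hxc, hτc]
        · rwa [hτ_def, Perm.mul_apply, swap_apply_of_ne_of_ne hxb hxc,
            swap_apply_of_ne_of_ne hxa hxb]
      rw [← hτB, ← hτa]
      exact Set.smul_mem_smul_set (a := (⟨τ, hτ⟩ : G)) haB
    let r : Setoid α :=
      { r := fun u v ↦ ∀ g ∈ G, g u ∈ B ↔ g v ∈ B
        iseqv := ⟨fun _ _ _ ↦ Iff.rfl, fun h g hg ↦ (h g hg).symm,
          fun h h' g hg ↦ (h g hg).trans (h' g hg)⟩ }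
    have mem_of_mem {u v : α} (hu : u ∈ B) (hv : v ∈ B) (g : Perm α) (hg : g ∈ G)
        (hgu : g u ∈ B) : g v ∈ B := by
      rw [← hB.smul_eq_of_mem (g := ⟨g, hg⟩) hu hgu]
      exact Set.smul_mem_smul_set (a := (⟨g, hg⟩ : G)) hv
    exact (htotal r (fun g hg u v h k hk ↦ h (k * g) (G.mul_mem hk hg))
      (fun g hg ↦ ⟨mem_of_mem haB hbB g hg, mem_of_mem hbB haB g hg⟩) v 1 G.one_mem).mp haB
  exact alternatingGroup_le_of_isPreprimitive_of_isThreeCycle_mem ‹_›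
    (isThreeCycle_swap_mul_swap_same hab.symm hbc hac) (swap_comm a b ▸ hτ)

end Perm

theorem sign_eq_one_of_pow_eq_one {α : Type*} [Fintype α] [DecidableEq α] {f : Equiv.Perm α}
    {n : ℕ} (hn : Odd n) (hf : f ^ n = 1) : Equiv.Perm.sign f = 1 := by
  have := congrArg Equiv.Perm.sign hf
  obtain ⟨k, rfl⟩ := hn
  rcases Int.units_eq_one_or (Equiv.Perm.sign f) with h | h
  · exact h
  · simp [h, pow_succ, pow_mul] at this

/-- Let `p` be an odd prime.  The three permutations of
`F_p^3 ∖ {0}` given by `σ(x,y,z) = (y,z,x)`, `α(x,y,z) = (x+y,y,z)` and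
`β(x,y,z) = (x+y²,y,z)` generate the full alternating group on `F_p^3 ∖ {0}`.
We realize `σ, α, β` as permutations of `F_p^3` fixing `0` (characterized by the
displayed formulas); the claim is then that the subgroup they generate equals the image
of the alternating group on `{v : F_p^3 // v ≠ 0}` under the embedding `ofSubtype`
(which extends a permutation of the nonzero vectors by fixing `0`). -/
theorem stmt15 (p : ℕ) [Fact p.Prime] (hodd : Odd p)
    (σ a β : Equiv.Perm (Fin 3 → ZMod p))
    (hσ : ∀ v (i : Fin 3), σ v i = v (i + 1))
    (ha : ∀ v (i : Fin 3), a v i = if i = 0 then v 0 + v 1 else v i)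
    (hβ : ∀ v (i : Fin 3), β v i = if i = 0 then v 0 + (v 1) ^ 2 else v i) :
    Subgroup.closure {σ, a, β} =
      Subgroup.map Equiv.Perm.ofSubtype
        (alternatingGroup {v : Fin 3 → ZMod p // v ≠ 0}) := by
  have h2 : (2 : ZMod p) ≠ 0 := by
    intro h
    have : p ∣ 2 := (ZMod.natCast_eq_zero_iff 2 p).mp (by exact_mod_cast h)
    rw [(Nat.prime_dvd_prime_iff_eq Fact.out Nat.prime_two).mp this] at hodd
    exact absurd hodd (by decide)
  have ha' : a = shear 0 fun y _ ↦ y := by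
    ext v j
    fin_cases j <;> simp [shear_apply, ha]
  have hβ' : β = shear 0 fun y _ ↦ y ^ 2 := by
    ext v j
    fin_cases j <;> simp [shear_apply, hβ]
  have hσ3 : σ ^ 3 = 1 := by
    ext v j
    fin_cases j <;> simp [pow_succ, hσ]
  have shear_pow (g : ZMod p → ZMod p → ZMod p) : shear 0 g ^ p = 1 := by
    rw [← shear_nsmul, ← shear_zero 0]
    congr 1
    ext y z
    simp
  set H := Subgroup.closure {σ, a, β} with hH
  have hσH : σ ∈ H := Subgroup.subset_closure (by simp)
  have hlin : (fun y _ ↦ y) ∈ shearSubmodule H :=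
    mem_shearSubmodule_of_rotate_mem hσ hσH (ha' ▸ Subgroup.subset_closure (by simp))
  have hsq : (fun y _ ↦ y ^ 2) ∈ shearSubmodule H :=
    mem_shearSubmodule_of_rotate_mem hσ hσH (hβ' ▸ Subgroup.subset_closure (by simp))
  have hsign : H ≤ alternatingGroup (Fin 3 → ZMod p) := by
    rw [hH, Subgroup.closure_le]
    rintro _ (rfl | rfl | rfl) <;> rw [SetLike.mem_coe, Equiv.Perm.mem_alternatingGroup]
    · exact sign_eq_one_of_pow_eq_one (by decide : Odd 3) hσ3
    · exact sign_eq_one_of_pow_eq_one hodd (ha' ▸ shear_pow _)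
    · exact sign_eq_one_of_pow_eq_one hodd (hβ' ▸ shear_pow _)
  have hfix (g : Equiv.Perm (Fin 3 → ZMod p)) (hg : g ∈ H) : g 0 = 0 := by
    suffices H ≤ MulAction.stabilizer (Equiv.Perm (Fin 3 → ZMod p)) (0 : Fin 3 → ZMod p) from
      this hg
    rw [hH, Subgroup.closure_le]
    rintro _ (rfl | rfl | rfl) <;> rw [SetLike.mem_coe, MulAction.mem_stabilizer_iff] <;> ext j
    · simp [hσ]
    · simp [ha]
    · simp [hβ]
  have hrange : H ≤ (Equiv.Perm.ofSubtype (p := fun v : Fin 3 → ZMod p ↦ v ≠ 0)).range := by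
    intro g hg
    have h0 (x : Fin 3 → ZMod p) : g x ≠ 0 ↔ x ≠ 0 := by
      rw [← hfix g hg, g.injective.ne_iff, hfix g hg]
    exact ⟨g.subtypePerm h0, Equiv.Perm.ofSubtype_subtypePerm _ fun x hx h ↦
      hx (h ▸ hfix g hg)⟩
  suffices H.comap Equiv.Perm.ofSubtype =
      alternatingGroup {v : Fin 3 → ZMod p // v ≠ 0} by
    rw [← this, Subgroup.map_comap_eq_self hrange]
  refine le_antisymm (fun g hg ↦ ?_) ?_
  · simpa [Equiv.Perm.mem_alternatingGroup] using hsign hg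
  obtain ⟨f, hf, h, hh, hf1, hh1, hfh⟩ := exists_mem_support_inter_eq h2 hlin hsq
  obtain ⟨f, rfl⟩ := hrange hf
  obtain ⟨h, rfl⟩ := hrange hh
  let c : {v : Fin 3 → ZMod p // v ≠ 0} := ⟨1, one_ne_zero⟩
  have hfc : (f c : Fin 3 → ZMod p) = ![0, 1, 1] := by
    rw [← Equiv.Perm.ofSubtype_apply_coe, ← hf1]
  have hfc' : f c ≠ c := fun heq ↦ by
    have := congrFun (hfc.symm.trans (congrArg Subtype.val heq)) 0
    simp [c] at this
  have hhc' : h c ≠ c := fun heq ↦ hh1 <| by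
    exact (Equiv.Perm.ofSubtype_apply_coe h c).trans (congrArg Subtype.val heq)
  have hsupp (x) (hx : f x ≠ x) (hx' : h x ≠ x) : x = c :=
    Subtype.ext <| hfh x (by simpa [Subtype.ext_iff] using hx) (by simpa [Subtype.ext_iff] using hx')
  have hne : f c ≠ h c := fun heq ↦ by
    have hhfc : h (f c) = f c := by
      by_contra hx
      exact hfc' (hsupp _ (fun heq ↦ hfc' (f.injective heq)) hx)
    exact hhc' (h.injective (by rw [← heq, hhfc]))
  have hτ := commutator_eq_swap_mul_swap hfc' hhc' hsupp
  refine alternatingGroup_le_of_swap_mul_swap_mem hfc'.symm hhc'.symm hne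
    (hτ ▸ mul_mem (mul_mem (mul_mem hf hh) (inv_mem hf)) (inv_mem hh)) fun r hr hrc v ↦ ?_
  let r' (u v : Fin 3 → ZMod p) : Prop := ∃ hu hv, r ⟨u, hu⟩ ⟨v, hv⟩
  have hr' (g) (hg : g ∈ H) (u v) : r' u v → r' (g u) (g v) := by
    rintro ⟨hu, hv, huv⟩
    obtain ⟨g, rfl⟩ := hrange hg
    rw [Equiv.Perm.ofSubtype_apply_of_mem g hu, Equiv.Perm.ofSubtype_apply_of_mem g hv]
    exact ⟨(g ⟨u, hu⟩).2, (g ⟨v, hv⟩).2, hr g hg _ _ huv⟩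
  obtain ⟨_, _, hv⟩ := rel_one_of_ne_zero (r := r')
    (fun ⟨hu, hv, huv⟩ ↦ ⟨hv, hu, r.symm' huv⟩)
    (fun ⟨hu, _, huv⟩ ⟨_, hw, hvw⟩ ↦ ⟨hu, hw, r.trans' huv hvw⟩) hσ (hr' σ hσH)
    (fun k i g hk hg ↦ hr' g (by
      rcases hg with rfl | rfl
      · exact (oneVar_mem_shearSubmodule h2 hlin hsq hk).1 i
      · exact (oneVar_mem_shearSubmodule h2 hlin hsq hk).2 i))
    (hfc ▸ ⟨one_ne_zero, (f c).2, hrc⟩) v.2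
  exact hv
end
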